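/- Let σ*(n) = ∑_{d || n} d denote the sum of unitary divisors of n, where d || n means d | n and gcd(d, n/d) = 1. Then limsup_{n→∞} σ*(n)/(n·log log n) = (6/π²)·e^γ. -/

import Mathlib

open Filter Real

/-- The logarithm of a factorial as a sum over primes. -/
lemma log_factorial_eq_sum_primesLE (N : ℕ) :
    log (N.factorial : ℝ) = ∑ p ∈ N.primesLE, (N.factorial.factorization p : ℝ) * log p := by
  have hN := N.factorial_ne_zero
  have hsupp : N.factorial.factorization.support ⊆ N.primesLE := by
    intro p hp
    rw [Nat.support_factorization, Nat.mem_primeFactors] at hp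
    exact Nat.mem_primesLE.2 ⟨(hp.1.dvd_factorial).1 hp.2.1, hp.1⟩
  conv_lhs => rw [← Nat.prod_factorization_pow_eq_self hN]
  rw [Finsupp.prod_of_support_subset _ hsupp _ (by simp), Nat.cast_prod, log_prod]
  · simp
  · intro p hp
    have := (Nat.mem_primesLE.1 hp).2.pos
    positivity

lemma div_sub_one_le_factorization_factorial {N p : ℕ} (hp : p.Prime) :
    (N : ℝ) / p - 1 ≤ N.factorial.factorization p := by
  have h : N / p ≤ N.factorial.factorization p := by
    rw [Nat.factorization_factorial hp (b := Nat.log p N + 2) (by omega)]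
    simpa using Finset.single_le_sum (f := fun i => N / p ^ i) (fun _ _ => Nat.zero_le _)
      (Finset.mem_Ico.2 ⟨le_rfl, by omega⟩ : 1 ∈ Finset.Ico 1 (Nat.log p N + 2))
  have h2 := Nat.lt_floor_add_one ((N : ℝ) / p)
  rw [Nat.floor_div_eq_div] at h2
  have h3 : ((N / p : ℕ) : ℝ) ≤ N.factorial.factorization p := by exact_mod_cast h
  linarith

lemma factorization_factorial_le_div {N p : ℕ} (hp : p.Prime) :
    (N.factorial.factorization p : ℝ) ≤ N / (p - 1) := by
  have h : (p - 1) * N.factorial.factorization p ≤ N := by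
    rw [Nat.sub_one_mul_factorization_factorial hp]
    exact Nat.sub_le _ _
  have h1 : (1 : ℝ) < p := by exact_mod_cast hp.one_lt
  rw [le_div_iff₀ (by linarith)]
  have h2 : (((p - 1) * N.factorial.factorization p : ℕ) : ℝ) ≤ N := by exact_mod_cast h
  rw [Nat.cast_mul, Nat.cast_sub hp.one_le] at h2
  push_cast at h2
  linarith

lemma sum_log_div_mul_sub_one_le : ∃ C : ℝ, ∀ N : ℕ,
    ∑ p ∈ N.primesLE, log p / (p * (p - 1)) ≤ C := by
  have hs : Summable (fun n : ℕ => 4 * (1 / (n : ℝ) ^ (3 / 2 : ℝ))) :=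
    (summable_one_div_nat_rpow.2 (by norm_num)).mul_left 4
  refine ⟨_, fun N => (Finset.sum_le_sum fun p hp => ?_).trans
    (hs.sum_le_tsum N.primesLE (fun _ _ => by positivity))⟩
  have h2 : (2 : ℝ) ≤ p := by exact_mod_cast (Nat.mem_primesLE.1 hp).2.two_le
  have hlog : log p ≤ 2 * (p : ℝ) ^ (1 / 2 : ℝ) := by
    have := log_le_rpow_div (x := (p : ℝ)) (by linarith) (ε := 1 / 2) (by norm_num)
    linarith
  have hpow : (p : ℝ) ^ (3 / 2 : ℝ) * (p : ℝ) ^ (1 / 2 : ℝ) = p * p := by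
    rw [← rpow_add (by linarith), ← sq, ← rpow_natCast]; norm_num
  have hpos : 0 < (p : ℝ) ^ (3 / 2 : ℝ) := by positivity
  rw [mul_one_div, div_le_div_iff₀ (by nlinarith) hpos]
  nlinarith [mul_le_mul_of_nonneg_left hlog hpos.le]

/-- **Mertens' first theorem.** -/
theorem abs_sum_primesLE_log_div_sub_log_le : ∃ C : ℝ, ∀ N : ℕ, N ≠ 0 →
    |∑ p ∈ N.primesLE, log p / p - log N| ≤ C := by
  obtain ⟨C, hC⟩ := sum_log_div_mul_sub_one_le
  refine ⟨max (log 4) (1 + C), fun N hN => ?_⟩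
  have hN0 : (0 : ℝ) < N := by positivity
  have hN1 : (1 : ℝ) ≤ N := by exact_mod_cast Nat.one_le_iff_ne_zero.2 hN
  have hlogp : ∀ p ∈ N.primesLE, 0 ≤ log (p : ℝ) := fun p _ => log_natCast_nonneg p
  have hup : log (N.factorial : ℝ) ≤ N * log N := by
    rw [← log_pow]
    exact log_le_log (by positivity) (by exact_mod_cast N.factorial_le_pow)
  have hlo : N * log N - N ≤ log (N.factorial : ℝ) := by
    have h1 := Stirling.le_log_factorial_stirling hN
    have h2 : 0 ≤ log (N : ℝ) := log_natCast_nonneg N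
    have h3 : 0 ≤ log (2 * π) := log_nonneg (by nlinarith [pi_gt_three])
    linarith
  have hlow : N * ∑ p ∈ N.primesLE, log p / p - log 4 * N ≤ log (N.factorial : ℝ) := by
    have h1 := Chebyshev.theta_le_log4_mul_x hN0.le
    rw [Chebyshev.theta_eq_sum_primesLE_log] at h1
    refine (sub_le_sub_left h1 _).trans ?_
    rw [log_factorial_eq_sum_primesLE, Finset.mul_sum, ← Finset.sum_sub_distrib]
    refine Finset.sum_le_sum fun p hp => ?_
    have := mul_le_mul_of_nonneg_right
      (div_sub_one_le_factorization_factorial (N := N) (Nat.mem_primesLE.1 hp).2) (hlogp p hp)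
    refine le_trans (le_of_eq ?_) this
    ring
  have hupp : log (N.factorial : ℝ) ≤ N * (∑ p ∈ N.primesLE, log p / p + C) := by
    refine le_trans ?_ (mul_le_mul_of_nonneg_left (add_le_add_right (hC N) _) hN0.le)
    rw [log_factorial_eq_sum_primesLE, ← Finset.sum_add_distrib, Finset.mul_sum]
    refine Finset.sum_le_sum fun p hp => ?_
    have hpp := (Nat.mem_primesLE.1 hp).2
    have h1 : (1 : ℝ) < p := by exact_mod_cast hpp.one_lt
    have := mul_le_mul_of_nonneg_right
      (factorization_factorial_le_div (N := N) hpp) (hlogp p hp)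
    refine this.trans (le_of_eq ?_)
    have : (p : ℝ) - 1 ≠ 0 := by linarith
    field_simp
    ring
  rw [abs_le]
  constructor
  · have : N * (log N - 1 - C - ∑ p ∈ N.primesLE, log p / p) ≤ (0 : ℝ) := by nlinarith
    have := nonpos_of_mul_nonpos_right this hN0
    have := le_max_right (log 4) (1 + C)
    linarith
  · have : N * (∑ p ∈ N.primesLE, log p / p - log N - log 4) ≤ (0 : ℝ) := by nlinarith
    have := nonpos_of_mul_nonpos_right this hN0
    have := le_max_left (log 4) (1 + C)
    linarith

lemma sum_range_ite_prime_add_two (g : ℕ → ℝ) (n : ℕ) :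
    ∑ i ∈ Finset.range n, (if (i + 2).Prime then g (i + 2) else 0) =
      ∑ p ∈ (n + 1).primesLE, g p := by
  have h : (n + 1).primesLE = (Finset.range (n + 2)).filter Nat.Prime := rfl
  rw [h, Finset.sum_filter, Finset.sum_range_succ', Finset.sum_range_succ']
  simp [Nat.not_prime_zero, Nat.not_prime_one, add_assoc]

/-- The errors in comparing the increments of `log ∘ log` over consecutive integers with their
linear approximations are summable. -/
lemma summable_log_sub_div_log_sub_log_log : Summable fun i : ℕ =>
    (log (i + 2 : ℝ) - log (i + 1 : ℝ)) / log (i + 2 : ℝ) -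
      (log (log (i + 2 : ℝ)) - log (log (i + 1 : ℝ))) := by
  rw [← summable_nat_add_iff 1]
  have hs : Summable fun i : ℕ => 2 * (1 / ((i + 1 : ℕ) : ℝ) ^ 2) :=
    ((summable_nat_add_iff 1).2 (summable_one_div_nat_pow.2 one_lt_two)).mul_left 2
  refine hs.of_norm_bounded fun i => ?_
  push_cast
  set a : ℝ := i + 1 + 1 with ha
  have ha2 : 2 ≤ a := by have : (0 : ℝ) ≤ i := i.cast_nonneg; linarith
  have hb : (i : ℝ) + 1 + 2 = a + 1 := by ring
  have hi : (i : ℝ) + 1 = a - 1 := by ring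
  rw [hb, hi]
  have hla : 0 < log a := log_pos (by linarith)
  have hlb : 1 ≤ log (a + 1) := by
    rw [le_log_iff_exp_le (by linarith)]
    linarith [exp_one_lt_d9]
  have hdiff : log (a + 1) - log a ≤ 1 / a := by
    rw [← log_div (by linarith) (by linarith)]
    refine (log_le_sub_one_of_pos (by positivity)).trans (le_of_eq ?_)
    field_simp
    ring
  have hdiff0 : 0 ≤ log (a + 1) - log a := sub_nonneg.2 (log_le_log (by linarith) (by linarith))
  set u := (log (a + 1) - log a) / log (a + 1) with hu
  have hu0 : 0 ≤ u := by positivity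
  have hua : u ≤ 1 / a := (div_le_self hdiff0 hlb).trans hdiff
  have hu2 : u ≤ 1 / 2 := hua.trans (one_div_le_one_div_of_le (by norm_num) ha2)
  have h1u : 1 - u = log a / log (a + 1) := by rw [hu]; field_simp; ring
  have hlog : log (1 - u) = log (log a) - log (log (a + 1)) := by
    rw [h1u, log_div hla.ne' (by linarith)]
  have key := abs_log_sub_add_sum_range_le (x := u) (by rw [abs_of_nonneg hu0]; linarith) 1
  simp only [Finset.sum_range_one, abs_of_nonneg hu0, hlog] at key
  rw [norm_eq_abs]
  have hle : u ^ (1 + 1) / (1 - u) ≤ 2 * (1 / (a - 1) ^ 2) := by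
    have h1 : u ^ 2 ≤ 1 / (a - 1) ^ 2 := by
      rw [← one_div_pow]
      exact pow_le_pow_left₀ hu0
        (hua.trans (one_div_le_one_div_of_le (by linarith) (by linarith))) 2
    rw [div_le_iff₀ (by linarith)]
    have : 0 ≤ 1 / (a - 1) ^ 2 := by positivity
    nlinarith
  refine le_trans (le_of_eq ?_) (key.trans hle)
  congr 1
  simp
  ring

/-- **Mertens' second theorem**, in qualitative form. -/
theorem exists_tendsto_sum_primesLE_inv_sub_log_log : ∃ M : ℝ,
    Tendsto (fun N : ℕ => ∑ p ∈ N.primesLE, 1 / (p : ℝ) - log (log N)) atTop (nhds M) := by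
  obtain ⟨C, hC⟩ := abs_sum_primesLE_log_div_sub_log_le
  set z : ℕ → ℝ := fun i =>
    (if (i + 2).Prime then log ((i + 2 : ℕ) : ℝ) / ((i + 2 : ℕ) : ℝ) else 0) -
    (log (i + 2 : ℝ) - log (i + 1 : ℝ)) with hz
  have hzsum : ∀ n, ‖∑ i ∈ Finset.range n, z i‖ ≤ C := by
    intro n
    have h2 : ∑ i ∈ Finset.range n, (log (i + 2 : ℝ) - log (i + 1 : ℝ)) = log ((n + 1 : ℕ) : ℝ) := by
      have := Finset.sum_range_sub (fun i : ℕ => log (i + 1 : ℝ)) n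
      simpa [add_assoc, one_add_one_eq_two] using this
    rw [hz, Finset.sum_sub_distrib,
      sum_range_ite_prime_add_two (fun p => log (p : ℝ) / (p : ℝ)), h2, norm_eq_abs]
    exact hC (n + 1) n.succ_ne_zero
  have hlogpos : ∀ i : ℕ, 0 < log (i + 2 : ℝ) := fun i =>
    log_pos (by have : (0 : ℝ) ≤ i := i.cast_nonneg; linarith)
  have hanti : Antitone fun i : ℕ => (log (i + 2 : ℝ))⁻¹ := by
    intro i j hij
    have : (i : ℝ) ≤ j := by exact_mod_cast hij
    exact inv_anti₀ (hlogpos i) (log_le_log (by positivity) (by linarith))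
  have hlim : Tendsto (fun i : ℕ => (log (i + 2 : ℝ))⁻¹) atTop (nhds 0) :=
    tendsto_inv_atTop_zero.comp (tendsto_log_atTop.comp
      (tendsto_atTop_add_const_right _ _ tendsto_natCast_atTop_atTop))
  obtain ⟨l, hl⟩ := cauchySeq_tendsto_of_complete
    (hanti.cauchySeq_series_mul_of_tendsto_zero_of_bounded hlim hzsum)
  have hw := summable_log_sub_div_log_sub_log_log.hasSum.tendsto_sum_nat
  refine ⟨_, (tendsto_add_atTop_iff_nat 1).1 ((hl.add hw).congr fun n => ?_)⟩
  have h2 : ∑ i ∈ Finset.range n, (log (log (i + 2 : ℝ)) - log (log (i + 1 : ℝ))) =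
      log (log ((n + 1 : ℕ) : ℝ)) := by
    have := Finset.sum_range_sub (fun i : ℕ => log (log (i + 1 : ℝ))) n
    simpa [add_assoc, one_add_one_eq_two] using this
  rw [← h2, ← sum_range_ite_prime_add_two (fun p => 1 / (p : ℝ)), ← Finset.sum_add_distrib,
    ← Finset.sum_sub_distrib]
  refine Finset.sum_congr rfl fun i _ => ?_
  have := (hlogpos i).ne'
  by_cases hp : (i + 2).Prime
  · simp only [hz, if_pos hp, smul_eq_mul]
    push_cast
    field_simp
    ring
  · simp only [hz, if_neg hp, smul_eq_mul]
    field_simp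
    ring

/-- Grouping the terms of a sum over `n ≤ e ^ K` according to the value of `⌈log n⌉₊`. -/
lemma sum_range_mul_sum_filter_ceil_log (a w : ℕ → ℝ) (K : ℕ) :
    ∑ k ∈ Finset.range (K + 1), w k *

    ∑ n ∈ (Finset.range (⌊exp k⌋₊ + 1)).filter (fun n : ℕ => ⌈log (n : ℝ)⌉₊ = k), a n =
      ∑ n ∈ Finset.range (⌊exp K⌋₊ + 1), w ⌈log (n : ℝ)⌉₊ * a n := by
  have hle : ∀ n k : ℕ, n < ⌊exp k⌋₊ + 1 ↔ ⌈log (n : ℝ)⌉₊ ≤ k := by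
    intro n k
    rw [Nat.lt_succ_iff, Nat.le_floor_iff (exp_pos _).le, Nat.ceil_le]
    rcases Nat.eq_zero_or_pos n with rfl | hn
    · simp [(exp_pos _).le]
    · rw [log_le_iff_le_exp (by exact_mod_cast hn)]
  rw [← Finset.sum_fiberwise_of_maps_to (s := Finset.range (⌊exp K⌋₊ + 1))
    (t := Finset.range (K + 1)) (g := fun n : ℕ => ⌈log (n : ℝ)⌉₊)]
  · refine Finset.sum_congr rfl fun k hk => ?_
    rw [Finset.mul_sum]
    have : (Finset.range (⌊exp k⌋₊ + 1)).filter (fun n : ℕ => ⌈log (n : ℝ)⌉₊ = k) =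
        (Finset.range (⌊exp K⌋₊ + 1)).filter (fun n : ℕ => ⌈log (n : ℝ)⌉₊ = k) := by
      ext n
      simp only [Finset.mem_filter, Finset.mem_range, hle]
      have := Finset.mem_range.1 hk
      omega
    rw [this]
    refine Finset.sum_congr rfl fun n hn => ?_
    rw [(Finset.mem_filter.1 hn).2]
  · intro n hn
    have := (hle n K).1 (Finset.mem_range.1 hn)
    exact Finset.mem_range.2 (by omega)

lemma tendsto_log_log_floor_exp_sub_log :
    Tendsto (fun K : ℕ => log (log (⌊exp K⌋₊ : ℝ)) - log K) atTop (nhds 0) := by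
  have hexp : Tendsto (fun K : ℕ => exp (K : ℝ)) atTop atTop :=
    tendsto_exp_atTop.comp tendsto_natCast_atTop_atTop
  have h1 : Tendsto (fun K : ℕ => (⌊exp K⌋₊ : ℝ) / exp K) atTop (nhds 1) :=
    (tendsto_nat_floor_div_atTop (R := ℝ)).comp hexp
  have h2 : Tendsto (fun K : ℕ => log ((⌊exp K⌋₊ : ℝ) / exp K)) atTop (nhds 0) := by
    simpa using h1.log one_ne_zero
  have h3 : Tendsto (fun K : ℕ => 1 + log ((⌊exp K⌋₊ : ℝ) / exp K) * (K : ℝ)⁻¹)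
      atTop (nhds 1) := by
    simpa using (h2.mul (tendsto_inv_atTop_zero.comp
      (tendsto_natCast_atTop_atTop (R := ℝ)))).const_add 1
  have h4 := h3.log one_ne_zero
  rw [log_one] at h4
  refine h4.congr' ?_
  filter_upwards [eventually_ge_atTop 2] with K hK
  have hK2 : (2 : ℝ) ≤ K := by exact_mod_cast hK
  have hfl : (2 : ℝ) ≤ ⌊exp K⌋₊ := by
    have : 2 ≤ ⌊exp (K : ℝ)⌋₊ := Nat.le_floor (by
      push_cast
      linarith [add_one_le_exp (K : ℝ)])
    exact_mod_cast this
  have hl : 0 < log (⌊exp K⌋₊ : ℝ) := log_pos (by linarith)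
  rw [log_div (by linarith) (exp_pos _).ne', log_exp, ← log_div hl.ne' (by linarith)]
  congr 1
  field_simp
  ring

lemma tendsto_log_one_sub_exp_neg_sub_log :
    Tendsto (fun δ : ℝ => log (1 - exp (-δ)) - log δ) (nhdsWithin 0 (Set.Ioi 0)) (nhds 0) := by
  have hd : HasDerivAt (fun δ : ℝ => 1 - exp (-δ)) 1 0 := by
    simpa using ((hasDerivAt_neg (0 : ℝ)).exp).const_sub 1
  have h := hd.tendsto_slope_zero_right
  have h2 := h.log one_ne_zero
  rw [log_one] at h2
  refine h2.congr' ?_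
  filter_upwards [self_mem_nhdsWithin] with δ (hδ : 0 < δ)
  have : exp (-δ) < 1 := exp_lt_one_iff.2 (by linarith)
  simp only [zero_add, neg_zero, exp_zero, sub_self, sub_zero, smul_eq_mul]
  rw [log_mul (by positivity) (by linarith), log_inv]
  ring

lemma exp_neg_mul_ceil_log_le (δ : ℝ) (hδ : 0 < δ) {n : ℕ} (hn : n ≠ 0) :
    exp (-δ) ^ ⌈log (n : ℝ)⌉₊ ≤ (n : ℝ) ^ (-δ) := by
  rw [← exp_nat_mul, rpow_def_of_pos (by positivity), exp_le_exp]
  nlinarith [Nat.le_ceil (log (n : ℝ))]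

lemma rpow_neg_le_exp_mul (δ : ℝ) (hδ : 0 < δ) {n : ℕ} (hn : n ≠ 0) :
    (n : ℝ) ^ (-δ) ≤ exp δ * exp (-δ) ^ ⌈log (n : ℝ)⌉₊ := by
  rw [← exp_nat_mul, rpow_def_of_pos (by positivity), ← exp_add, exp_le_exp]
  nlinarith [Nat.ceil_lt_add_one (log_natCast_nonneg n)]

/-- If `∑ n ≤ N, a n = log log N + M + o(1)` with `a ≥ 0`, then
`∑ a n / n ^ δ = log (1 / δ) + M - γ + o(1)` as `δ → 0⁺`. -/
theorem tendsto_tsum_mul_rpow_neg_add_log {a : ℕ → ℝ} {M : ℝ} (ha : ∀ n, 0 ≤ a n) (ha0 : a 0 = 0)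
    (hs : ∀ δ : ℝ, 0 < δ → Summable fun n : ℕ => (n : ℝ) ^ (-δ) * a n)
    (hM : Tendsto (fun N : ℕ => ∑ n ∈ Finset.range (N + 1), a n - log (log N)) atTop (nhds M)) :
    Tendsto (fun δ : ℝ => ∑' n : ℕ, (n : ℝ) ^ (-δ) * a n + log δ) (nhdsWithin 0 (Set.Ioi 0))
      (nhds (M - eulerMascheroniConstant)) := by
  set f : ℕ → ℝ := fun k =>
    ∑ n ∈ (Finset.range (⌊exp k⌋₊ + 1)).filter (fun n : ℕ => ⌈log (n : ℝ)⌉₊ = k), a n with hf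
  have hf0 : ∀ k, 0 ≤ f k := fun k => Finset.sum_nonneg fun n _ => ha n
  have hfloor : Tendsto (fun K : ℕ => ⌊exp (K : ℝ)⌋₊) atTop atTop :=
    tendsto_nat_floor_atTop.comp (tendsto_exp_atTop.comp tendsto_natCast_atTop_atTop)
  set d : ℕ → ℝ := fun k => f k - (k : ℝ)⁻¹ with hd
  have hdsum : Tendsto (fun n => ∑ k ∈ Finset.range n, d k) atTop
      (nhds (M - eulerMascheroniConstant)) := by
    rw [← tendsto_add_atTop_iff_nat 1]
    have h := ((hM.comp hfloor).sub tendsto_harmonic_sub_log).add tendsto_log_log_floor_exp_sub_log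
    rw [add_zero] at h
    refine h.congr fun K => ?_
    have h1 := sum_range_mul_sum_filter_ceil_log a (fun _ => 1) K
    simp only [one_mul] at h1
    rw [hd, Finset.sum_sub_distrib, h1, Finset.sum_range_succ' (fun k : ℕ => (k : ℝ)⁻¹)]
    simp [harmonic]
    ring
  set G : ℝ → ℝ := fun δ => ∑' n : ℕ, exp (-δ) ^ ⌈log (n : ℝ)⌉₊ * a n with hG
  have hle1 : ∀ δ : ℝ, 0 < δ → ∀ n : ℕ,
      exp (-δ) ^ ⌈log (n : ℝ)⌉₊ * a n ≤ (n : ℝ) ^ (-δ) * a n := by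
    intro δ hδ n
    rcases eq_or_ne n 0 with rfl | hn
    · simp [ha0]
    · exact mul_le_mul_of_nonneg_right (exp_neg_mul_ceil_log_le δ hδ hn) (ha n)
  have hle2 : ∀ δ : ℝ, 0 < δ → ∀ n : ℕ,
      (n : ℝ) ^ (-δ) * a n ≤ exp δ * (exp (-δ) ^ ⌈log (n : ℝ)⌉₊ * a n) := by
    intro δ hδ n
    rcases eq_or_ne n 0 with rfl | hn
    · simp [ha0]
    · rw [← mul_assoc]
      exact mul_le_mul_of_nonneg_right (rpow_neg_le_exp_mul δ hδ hn) (ha n)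
  have hGs : ∀ δ : ℝ, 0 < δ → Summable fun n : ℕ => exp (-δ) ^ ⌈log (n : ℝ)⌉₊ * a n :=
    fun δ hδ => (hs δ hδ).of_nonneg_of_le
      (fun n => mul_nonneg (by positivity) (ha n)) (hle1 δ hδ)
  have hGS : ∀ δ : ℝ, 0 < δ → G δ ≤ ∑' n : ℕ, (n : ℝ) ^ (-δ) * a n := fun δ hδ =>
    (hGs δ hδ).tsum_le_tsum (hle1 δ hδ) (hs δ hδ)
  have hSG : ∀ δ : ℝ, 0 < δ → ∑' n : ℕ, (n : ℝ) ^ (-δ) * a n ≤ exp δ * G δ := fun δ hδ => by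
    rw [hG, ← tsum_mul_left]
    exact (hs δ hδ).tsum_le_tsum (hle2 δ hδ) ((hGs δ hδ).mul_left _)
  have hGd : ∀ δ : ℝ, 0 < δ → ∑' k, d k * exp (-δ) ^ k = G δ + log (1 - exp (-δ)) := by
    intro δ hδ
    have hz1 : exp (-δ) < 1 := exp_lt_one_iff.2 (by linarith)
    have hfG : HasSum (fun k => exp (-δ) ^ k * f k) (G δ) := by
      rw [hasSum_iff_tendsto_nat_of_nonneg (fun k => mul_nonneg (by positivity) (hf0 k)),
        ← tendsto_add_atTop_iff_nat 1]
      have h1 := ((tendsto_add_atTop_iff_nat 1).2 (hGs δ hδ).hasSum.tendsto_sum_nat).comp hfloor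
      refine h1.congr fun K => ?_
      exact (sum_range_mul_sum_filter_ceil_log a (fun k => exp (-δ) ^ k) K).symm
    have hlog : HasSum (fun k : ℕ => (k : ℝ)⁻¹ * exp (-δ) ^ k) (-log (1 - exp (-δ))) := by
      have h1 := hasSum_pow_div_log_of_abs_lt_one (x := exp (-δ))
        (by rwa [abs_of_pos (exp_pos _)])
      rw [← hasSum_nat_add_iff' 1]
      simpa [div_eq_inv_mul] using h1
    have := (hfG.sub hlog).tsum_eq
    rw [sub_neg_eq_add] at this
    rw [← this]
    refine tsum_congr fun k => ?_
    rw [hd]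
    ring
  have hexp : Tendsto (fun δ : ℝ => exp (-δ)) (nhdsWithin 0 (Set.Ioi 0))
      (nhdsWithin 1 (Set.Iio 1)) := by
    refine tendsto_nhdsWithin_iff.2 ⟨?_, ?_⟩
    · have : Tendsto (fun δ : ℝ => exp (-δ)) (nhds 0) (nhds (exp (-0))) :=
        (continuous_exp.comp continuous_neg).tendsto 0
      rw [neg_zero, exp_zero] at this
      exact this.mono_left nhdsWithin_le_nhds
    · filter_upwards [self_mem_nhdsWithin] with δ (hδ : 0 < δ)
      exact exp_lt_one_iff.2 (by linarith)
  have hGlim : Tendsto (fun δ => G δ + log (1 - exp (-δ))) (nhdsWithin 0 (Set.Ioi 0))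
      (nhds (M - eulerMascheroniConstant)) := by
    refine ((tendsto_tsum_powerSeries_nhdsWithin_lt hdsum).comp hexp).congr' ?_
    filter_upwards [self_mem_nhdsWithin] with δ hδ
    exact hGd δ hδ
  have hlow : Tendsto (fun δ => G δ + log δ) (nhdsWithin 0 (Set.Ioi 0))
      (nhds (M - eulerMascheroniConstant)) := by
    have := hGlim.sub tendsto_log_one_sub_exp_neg_sub_log
    rw [sub_zero] at this
    refine this.congr fun δ => ?_
    ring
  have hy : Tendsto (fun δ : ℝ => exp δ - 1) (nhdsWithin 0 (Set.Ioi 0)) (nhds 0) := by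
    have : Tendsto (fun δ : ℝ => exp δ - 1) (nhds 0) (nhds (exp 0 - 1)) :=
      (continuous_exp.sub continuous_const).tendsto 0
    rw [exp_zero, sub_self] at this
    exact this.mono_left nhdsWithin_le_nhds
  have hylog : Tendsto (fun δ : ℝ => (exp δ - 1) * log (1 - exp (-δ)))
      (nhdsWithin 0 (Set.Ioi 0)) (nhds 0) := by
    have hc : Continuous fun δ : ℝ => exp δ * ((1 - exp (-δ)) * log (1 - exp (-δ))) :=
      continuous_exp.mul (continuous_mul_log.comp (by fun_prop))
    have h1 := hc.tendsto 0
    simp only [neg_zero, exp_zero, sub_self, zero_mul, mul_zero] at h1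
    refine (h1.mono_left nhdsWithin_le_nhds).congr fun δ => ?_
    rw [← mul_assoc, mul_sub, ← exp_add]
    simp
  have hup : Tendsto (fun δ => exp δ * G δ + log δ) (nhdsWithin 0 (Set.Ioi 0))
      (nhds (M - eulerMascheroniConstant)) := by
    have := (hlow.add (hy.mul hGlim)).sub hylog
    simp only [zero_mul, add_zero, sub_zero] at this
    refine this.congr fun δ => ?_
    ring
  refine tendsto_of_tendsto_of_tendsto_of_le_of_le' hlow hup ?_ ?_
  · filter_upwards [self_mem_nhdsWithin] with δ hδ
    linarith [hGS δ hδ]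
  · filter_upwards [self_mem_nhdsWithin] with δ hδ
    linarith [hSG δ hδ]

/-- The remainder of `-log (1 - x)` after its linear term. -/
noncomputable def negLogOneSubRem (x : ℝ) : ℝ := -log (1 - x) - x

lemma abs_negLogOneSubRem_le {x : ℝ} (hx : |x| ≤ 1 / 2) : |negLogOneSubRem x| ≤ 2 * x ^ 2 := by
  have key := abs_log_sub_add_sum_range_le (x := x) (by linarith) 1
  have h : negLogOneSubRem x =
      -(∑ i ∈ Finset.range 1, x ^ (i + 1) / ((i : ℝ) + 1) + log (1 - x)) := by
    simp [negLogOneSubRem]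
    ring
  rw [h, abs_neg]
  refine key.trans ?_
  rw [div_le_iff₀ (by linarith), ← sq_abs x]
  have := mul_nonneg (sq_nonneg |x|) (sub_nonneg.2 hx)
  rw [one_add_one_eq_two]
  linarith

lemma summable_ite_prime_of_le_inv_sq {g : ℕ → ℝ}
    (hg : ∀ p, p.Prime → |g p| ≤ 2 * (1 / p : ℝ) ^ 2) :
    Summable fun n : ℕ => if n.Prime then g n else 0 := by
  refine ((summable_one_div_nat_pow.2 one_lt_two).mul_left 2).of_norm_bounded fun n => ?_
  split_ifs with hp
  · simpa using hg n hp
  · simp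

lemma natCast_rpow_neg_le_one_div {s : ℝ} (hs : 1 ≤ s) {p : ℕ} (hp : p.Prime) :
    (p : ℝ) ^ (-s) ≤ 1 / p := by
  have h1 : (1 : ℝ) ≤ p := by exact_mod_cast hp.one_le
  rw [one_div, ← rpow_neg_one]
  exact rpow_le_rpow_of_exponent_le h1 (by linarith)

lemma one_div_prime_le_half {p : ℕ} (hp : p.Prime) : 1 / (p : ℝ) ≤ 1 / 2 :=
  one_div_le_one_div_of_le two_pos (by exact_mod_cast hp.two_le)

lemma abs_negLogOneSubRem_rpow_le {s : ℝ} (hs : 1 ≤ s) {p : ℕ} (hp : p.Prime) :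
    |negLogOneSubRem ((p : ℝ) ^ (-s))| ≤ 2 * (1 / p : ℝ) ^ 2 := by
  have h0 : 0 ≤ (p : ℝ) ^ (-s) := by positivity
  have h1 := natCast_rpow_neg_le_one_div hs hp
  refine (abs_negLogOneSubRem_le ?_).trans ?_
  · rw [abs_of_nonneg h0]
    exact h1.trans (one_div_prime_le_half hp)
  · gcongr

lemma summable_ite_prime_rpow {s : ℝ} (hs : 1 < s) :
    Summable fun n : ℕ => if n.Prime then (n : ℝ) ^ (-s) else 0 := by
  refine (summable_nat_rpow.2 (by linarith : -s < -1)).of_nonneg_of_le (fun n => ?_) fun n => ?_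
  all_goals split_ifs <;> first | positivity | exact le_rfl

/-- The logarithm of the Euler product, split into its linear term and a remainder. -/
lemma tsum_prime_rpow_add_tsum_negLogOneSubRem {s : ℝ} (hs : 1 < s) :
    ∑' n : ℕ, (if n.Prime then (n : ℝ) ^ (-s) else 0) +
      ∑' n : ℕ, (if n.Prime then negLogOneSubRem ((n : ℝ) ^ (-s)) else 0) =
      log (∑' n : ℕ, (n : ℝ) ^ (-s)) := by
  let f : ℕ →*₀ ℝ :=
    { toFun := fun n => (n : ℝ) ^ (-s)
      map_zero' := by rw [Nat.cast_zero, zero_rpow (by linarith)]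
      map_one' := by simp
      map_mul' := fun m n => by
        rw [Nat.cast_mul, mul_rpow (Nat.cast_nonneg _) (Nat.cast_nonneg _)] }
  have hsum : Summable fun n : ℕ => (n : ℝ) ^ (-s) := summable_nat_rpow.2 (by linarith)
  have hprod := EulerProduct.eulerProduct_completely_multiplicative (f := f) hsum.norm
  have hpos : 0 < ∑' n : ℕ, (n : ℝ) ^ (-s) :=
    hsum.tsum_pos (fun n => by positivity) 1 (by simp)
  have hlog := hprod.log hpos.ne'
  have h1 := (summable_ite_prime_rpow hs).hasSum.tendsto_sum_nat
  have h2 := (summable_ite_prime_of_le_inv_sq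
    fun p hp => abs_negLogOneSubRem_rpow_le hs.le hp).hasSum.tendsto_sum_nat
  refine tendsto_nhds_unique ((h1.add h2).congr fun N => ?_) hlog
  have hlt : ∀ p : ℕ, p.Prime → (p : ℝ) ^ (-s) < 1 := fun p hp =>
    ((natCast_rpow_neg_le_one_div hs.le hp).trans (one_div_prime_le_half hp)).trans_lt
      (by norm_num)
  rw [Nat.primesBelow_eq_filter_range, log_prod, Finset.sum_filter, ← Finset.sum_add_distrib]
  · refine Finset.sum_congr rfl fun p _ => ?_
    split_ifs with hp
    · simp [f, negLogOneSubRem]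
    · simp
  · intro p hp
    have := hlt p (Finset.mem_filter.1 hp).2
    exact inv_ne_zero (sub_ne_zero.2 this.ne')

lemma tendsto_tsum_negLogOneSubRem :
    Tendsto (fun δ : ℝ => ∑' n : ℕ,
        (if n.Prime then negLogOneSubRem ((n : ℝ) ^ (-(1 + δ))) else 0))
      (nhdsWithin 0 (Set.Ioi 0))
      (nhds (∑' n : ℕ, (if n.Prime then negLogOneSubRem (1 / n) else 0))) := by
  refine tendsto_tsum_of_dominated_convergence
    ((summable_one_div_nat_pow.2 one_lt_two).mul_left 2) (fun n => ?_) ?_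
  · split_ifs with hp
    · have hp0 : (0 : ℝ) < n := by exact_mod_cast hp.pos
      have h1 : Tendsto (fun δ : ℝ => (n : ℝ) ^ (-(1 + δ))) (nhds 0) (nhds (1 / n)) := by
        have hc : Continuous fun δ : ℝ => (n : ℝ) ^ (-(1 + δ)) :=
          Continuous.rpow continuous_const (by fun_prop) fun _ => Or.inl hp0.ne'
        simpa [rpow_neg_one] using hc.tendsto 0
      have h2 : 1 - 1 / (n : ℝ) ≠ 0 := by linarith [one_div_prime_le_half hp]
      exact (((h1.const_sub 1).log h2).neg.sub h1).mono_left nhdsWithin_le_nhds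
    · exact tendsto_const_nhds
  · filter_upwards [self_mem_nhdsWithin] with δ (hδ : 0 < δ) n
    split_ifs with hp
    · simpa using abs_negLogOneSubRem_rpow_le (s := 1 + δ) (by linarith) hp
    · simp

lemma tendsto_log_tsum_rpow_add_log :
    Tendsto (fun δ : ℝ => log (∑' n : ℕ, (n : ℝ) ^ (-(1 + δ))) + log δ)
      (nhdsWithin 0 (Set.Ioi 0)) (nhds 0) := by
  have hshift : Tendsto (fun δ : ℝ => 1 + δ) (nhdsWithin 0 (Set.Ioi 0))
      (nhdsWithin 1 (Set.Ioi 1)) := by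
    refine tendsto_nhdsWithin_iff.2 ⟨?_, ?_⟩
    · have : Tendsto (fun δ : ℝ => 1 + δ) (nhds 0) (nhds (1 + 0)) :=
        (continuous_const.add continuous_id).tendsto 0
      rw [add_zero] at this
      exact this.mono_left nhdsWithin_le_nhds
    · filter_upwards [self_mem_nhdsWithin] with δ (hδ : 0 < δ)
      exact lt_add_of_pos_right 1 hδ
  have h := (tendsto_sub_mul_tsum_nat_rpow.comp hshift).log one_ne_zero
  rw [log_one] at h
  refine h.congr' ?_
  filter_upwards [self_mem_nhdsWithin] with δ (hδ : 0 < δ)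
  have hpos : 0 < ∑' n : ℕ, (n : ℝ) ^ (-(1 + δ)) :=
    (summable_nat_rpow.2 (by linarith)).tsum_pos (fun n => by positivity) 1 (by simp)
  have heq : ∑' n : ℕ, 1 / (n : ℝ) ^ (1 + δ) = ∑' n : ℕ, (n : ℝ) ^ (-(1 + δ)) :=
    tsum_congr fun n => by rw [rpow_neg (Nat.cast_nonneg n), one_div]
  simp only [Function.comp_apply, add_sub_cancel_left, heq]
  rw [log_mul hδ.ne' hpos.ne', add_comm]

/-- **Mertens' second theorem**, with the value of the constant. -/
theorem tendsto_sum_primesLE_inv_sub_log_log :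
    Tendsto (fun N : ℕ => ∑ p ∈ N.primesLE, 1 / (p : ℝ) - log (log N)) atTop
      (nhds (eulerMascheroniConstant -
        ∑' n : ℕ, (if n.Prime then negLogOneSubRem (1 / n) else 0))) := by
  obtain ⟨M, hM⟩ := exists_tendsto_sum_primesLE_inv_sub_log_log
  have hterm : ∀ δ : ℝ, (fun n : ℕ => (n : ℝ) ^ (-δ) * (if n.Prime then 1 / (n : ℝ) else 0)) =
      fun n : ℕ => if n.Prime then (n : ℝ) ^ (-(1 + δ)) else 0 := by
    intro δ
    funext n
    split_ifs with hp
    · have hp0 : (0 : ℝ) < n := by exact_mod_cast hp.pos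
      rw [neg_add_rev, rpow_add hp0, rpow_neg_one, one_div]
    · simp
  have h := tendsto_tsum_mul_rpow_neg_add_log (a := fun n => if n.Prime then 1 / (n : ℝ) else 0)
    (M := M) (fun n => by positivity) (by simp)
    (fun δ hδ => by
      rw [hterm]
      exact summable_ite_prime_rpow (by linarith))
    (hM.congr fun N => by
      rw [← Finset.sum_filter]
      rfl)
  simp only [hterm] at h
  have h2 := tendsto_log_tsum_rpow_add_log.sub tendsto_tsum_negLogOneSubRem
  have h3 : M - eulerMascheroniConstant =
      0 - ∑' n : ℕ, (if n.Prime then negLogOneSubRem (1 / n) else 0) := by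
    refine tendsto_nhds_unique h (h2.congr' ?_)
    filter_upwards [self_mem_nhdsWithin] with δ (hδ : 0 < δ)
    rw [← tsum_prime_rpow_add_tsum_negLogOneSubRem (by linarith)]
    ring
  convert hM using 2
  linarith

lemma tsum_negLogOneSubRem_add_tsum_neg :
    ∑' n : ℕ, (if n.Prime then negLogOneSubRem (1 / n) else 0) +
      ∑' n : ℕ, (if n.Prime then negLogOneSubRem (-(1 / n)) else 0) = log (π ^ 2 / 6) := by
  have hb : ∀ p : ℕ, p.Prime → |1 / (p : ℝ)| ≤ 1 / 2 := fun p hp => by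
    rw [abs_of_nonneg (by positivity)]
    exact one_div_prime_le_half hp
  have hs1 : Summable fun n : ℕ => if n.Prime then negLogOneSubRem (1 / n) else 0 :=
    summable_ite_prime_of_le_inv_sq (g := fun n => negLogOneSubRem (1 / n))
      fun p hp => abs_negLogOneSubRem_le (hb p hp)
  have hs2 : Summable fun n : ℕ => if n.Prime then negLogOneSubRem (-(1 / n)) else 0 :=
    summable_ite_prime_of_le_inv_sq (g := fun n => negLogOneSubRem (-(1 / n)))
      fun p hp => by
        have := abs_negLogOneSubRem_le (x := -(1 / (p : ℝ))) (by rw [abs_neg]; exact hb p hp)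
        rwa [neg_sq] at this
  have h2 : ∀ n : ℕ, (n : ℝ) ^ (-2 : ℝ) = 1 / (n : ℝ) ^ 2 := fun n => by
    rw [rpow_neg (Nat.cast_nonneg n), one_div]
    norm_cast
  rw [← hasSum_zeta_two.tsum_eq, ← tsum_congr h2,
    ← tsum_prime_rpow_add_tsum_negLogOneSubRem one_lt_two, ← hs1.tsum_add hs2,
    ← (summable_ite_prime_rpow one_lt_two).tsum_add (summable_ite_prime_of_le_inv_sq
      fun p hp => abs_negLogOneSubRem_rpow_le one_le_two hp)]
  refine tsum_congr fun n => ?_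
  split_ifs with hp
  · have h3 := abs_le.1 (hb n hp)
    rw [h2]
    simp only [negLogOneSubRem]
    have : 1 - 1 / (n : ℝ) ^ 2 = (1 - 1 / n) * (1 - -(1 / n)) := by
      rw [← one_div_pow]
      ring
    rw [this, log_mul (by linarith) (by linarith)]
    ring
  · simp

/-- **Mertens' third theorem** for the product of `1 + 1 / p`. -/
theorem tendsto_prod_primesLE_one_add_inv_div_log :
    Tendsto (fun N : ℕ => (∏ p ∈ N.primesLE, (1 + 1 / (p : ℝ))) / log N) atTop
      (nhds (6 / π ^ 2 * exp eulerMascheroniConstant)) := by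
  have hs : Summable fun n : ℕ => if n.Prime then negLogOneSubRem (-(1 / n)) else 0 :=
    summable_ite_prime_of_le_inv_sq (g := fun n => negLogOneSubRem (-(1 / n)))
      fun p hp => by
        have := abs_negLogOneSubRem_le (x := -(1 / (p : ℝ))) (by
          rw [abs_neg, abs_of_nonneg (by positivity)]
          exact one_div_prime_le_half hp)
        rwa [neg_sq] at this
  have h := tendsto_sum_primesLE_inv_sub_log_log.sub
    ((tendsto_add_atTop_iff_nat 1).2 hs.hasSum.tendsto_sum_nat)
  have hL : exp (eulerMascheroniConstant -
        ∑' n : ℕ, (if n.Prime then negLogOneSubRem (1 / n) else 0) -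
        ∑' n : ℕ, (if n.Prime then negLogOneSubRem (-(1 / n)) else 0)) =
      6 / π ^ 2 * exp eulerMascheroniConstant := by
    rw [sub_sub, tsum_negLogOneSubRem_add_tsum_neg, exp_sub, exp_log (by positivity)]
    field_simp
  rw [← hL]
  refine ((continuous_exp.tendsto _).comp h).congr' ?_
  filter_upwards [eventually_ge_atTop 2] with N hN
  have hlog : 0 < log (N : ℝ) := log_pos (by exact_mod_cast hN)
  have hpos : 0 < ∏ p ∈ N.primesLE, (1 + 1 / (p : ℝ)) :=
    Finset.prod_pos fun p _ => by positivity
  rw [Function.comp_apply, ← exp_log (div_pos hpos hlog), log_div hpos.ne' hlog.ne', log_prod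
    (fun p _ => by positivity), ← Finset.sum_filter]
  congr 1
  have : (Finset.range (N + 1)).filter Nat.Prime = N.primesLE := rfl
  rw [this, sub_right_comm, ← Finset.sum_sub_distrib]
  congr 1
  refine Finset.sum_congr rfl fun p _ => ?_
  rw [negLogOneSubRem, sub_neg_eq_add, sub_neg_eq_add]
  ring

lemma factorization_of_coprime_div {n d p : ℕ} (hn : n ≠ 0) (hd : d ∣ n)
    (h : Nat.gcd d (n / d) = 1) :
    d.factorization p = if p ∈ (n / d).primeFactors then 0 else n.factorization p := by
  have hd0 : d ≠ 0 := ne_zero_of_dvd_ne_zero hn hd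
  have hnd0 : n / d ≠ 0 := (Nat.div_pos (Nat.le_of_dvd (Nat.pos_of_ne_zero hn) hd)
    (Nat.pos_of_ne_zero hd0)).ne'
  have hmul : n.factorization p = d.factorization p + (n / d).factorization p := by
    conv_lhs => rw [← Nat.mul_div_cancel' hd, Nat.factorization_mul hd0 hnd0]
    rfl
  split_ifs with hp
  · rw [Nat.mem_primeFactors] at hp
    refine Nat.factorization_eq_zero_of_not_dvd fun hpd => hp.1.one_lt.ne' ?_
    exact Nat.dvd_one.1 (h ▸ Nat.dvd_gcd hpd hp.2.1)
  · have : (n / d).factorization p = 0 := by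
      rwa [← Nat.support_factorization, Finsupp.notMem_support_iff] at hp
    omega

/-- The unitary divisor sum is at most `n * ∏ p ∣ n, (1 + 1 / p)`. -/
lemma sum_unitary_divisors_le {n : ℕ} (hn : n ≠ 0) :
    ((∑ d ∈ n.divisors.filter (fun d => Nat.gcd d (n / d) = 1), d : ℕ) : ℝ) ≤
      n * ∏ p ∈ n.primeFactors, (1 + 1 / (p : ℝ)) := by
  rw [Finset.prod_one_add, Finset.mul_sum, Nat.cast_sum]
  set U := n.divisors.filter (fun d => Nat.gcd d (n / d) = 1) with hU
  have hmem : ∀ d ∈ U, d ∣ n ∧ Nat.gcd d (n / d) = 1 := fun d hd => by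
    rw [hU, Finset.mem_filter, Nat.mem_divisors] at hd
    exact ⟨hd.1.1, hd.2⟩
  have hinj : Set.InjOn (fun d => (n / d).primeFactors) U := by
    intro d hd e he hde
    obtain ⟨hdn, hdg⟩ := hmem d hd
    obtain ⟨hen, heg⟩ := hmem e he
    refine Nat.eq_of_factorization_eq (ne_zero_of_dvd_ne_zero hn hdn)
      (ne_zero_of_dvd_ne_zero hn hen) fun p => ?_
    rw [factorization_of_coprime_div hn hdn hdg, factorization_of_coprime_div hn hen heg]
    simp only at hde
    rw [hde]
  calc ∑ d ∈ U, (d : ℝ)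
      ≤ ∑ d ∈ U, (n : ℝ) * ∏ p ∈ (n / d).primeFactors, 1 / (p : ℝ) := by
        refine Finset.sum_le_sum fun d hd => ?_
        obtain ⟨hdn, -⟩ := hmem d hd
        have hdpos : 0 < n / d := Nat.div_pos (Nat.le_of_dvd (Nat.pos_of_ne_zero hn) hdn)
          (Nat.pos_of_ne_zero (ne_zero_of_dvd_ne_zero hn hdn))
        have hle : ∏ p ∈ (n / d).primeFactors, p ≤ n / d :=
          Nat.le_of_dvd hdpos (Nat.prod_primeFactors_dvd _)
        have hppos : 0 < ∏ p ∈ (n / d).primeFactors, (p : ℝ) :=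
          Finset.prod_pos fun p hp => by exact_mod_cast (Nat.prime_of_mem_primeFactors hp).pos
        rw [Finset.prod_div_distrib, Finset.prod_const_one, mul_one_div, le_div_iff₀ hppos]
        have h2 : d * ∏ p ∈ (n / d).primeFactors, p ≤ n :=
          (Nat.mul_le_mul_left d hle).trans (Nat.mul_div_cancel' hdn).le
        have h3 := (Nat.cast_le (α := ℝ)).2 h2
        push_cast at h3
        exact h3
    _ = ∑ t ∈ U.image (fun d => (n / d).primeFactors), (n : ℝ) * ∏ p ∈ t, 1 / (p : ℝ) := by
        rw [Finset.sum_image hinj]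
    _ ≤ _ := by
        refine Finset.sum_le_sum_of_subset_of_nonneg ?_ fun t _ _ => by positivity
        intro t ht
        obtain ⟨d, hd, rfl⟩ := Finset.mem_image.1 ht
        exact Finset.mem_powerset.2
          (Nat.primeFactors_mono (Nat.div_dvd_of_dvd (hmem d hd).1) hn)

lemma sum_unitary_divisors_of_squarefree {n : ℕ} (hn : Squarefree n) :
    ((∑ d ∈ n.divisors.filter (fun d => Nat.gcd d (n / d) = 1), d : ℕ) : ℝ) =
      n * ∏ p ∈ n.primeFactors, (1 + 1 / (p : ℝ)) := by
  have h1 : n.divisors.filter (fun d => Nat.gcd d (n / d) = 1) = n.divisors := by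
    refine Finset.filter_true_of_mem fun d hd => ?_
    have hd' := (Nat.mem_divisors.1 hd).1
    rw [← Nat.mul_div_cancel' hd'] at hn
    exact Nat.coprime_of_squarefree_mul hn
  have h2 := ArithmeticFunction.IsMultiplicative.prodPrimeFactors_one_add_of_squarefree
    (ArithmeticFunction.isMultiplicative_id) hn
  simp only [ArithmeticFunction.id_apply] at h2
  rw [h1, ← h2]
  have h3 : (n : ℝ) = ∏ p ∈ n.primeFactors, (p : ℝ) := by
    conv_lhs => rw [← Nat.prod_primeFactors_of_squarefree hn]
    push_cast
    rfl
  rw [h3, ← Finset.prod_mul_distrib]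
  push_cast
  refine Finset.prod_congr rfl fun p hp => ?_
  have : (p : ℝ) ≠ 0 := by exact_mod_cast (Nat.prime_of_mem_primeFactors hp).ne_zero
  field_simp
  exact add_comm _ _

/-- The contribution of the primes exceeding `log n` to `∏ p ∣ n, (1 + 1 / p)` is negligible. -/
lemma prod_primeFactors_one_add_inv_le {n : ℕ} (hn : n ≠ 0) (hlog : 1 < log (n : ℝ)) :
    ∏ p ∈ n.primeFactors, (1 + 1 / (p : ℝ)) ≤
      (∏ p ∈ (⌊log (n : ℝ)⌋₊).primesLE, (1 + 1 / (p : ℝ))) * exp (1 / log (log n)) := by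
  set y := log (n : ℝ) with hy
  have hly : 0 < log y := log_pos hlog
  rw [← Finset.prod_filter_mul_prod_filter_not n.primeFactors (fun p : ℕ => (p : ℝ) ≤ y)]
  refine mul_le_mul ?_ ?_ (Finset.prod_nonneg fun p _ => by positivity)
    (Finset.prod_nonneg fun p _ => by positivity)
  · refine Finset.prod_le_prod_of_subset_of_one_le (fun p hp => ?_) (fun p _ => by positivity)
      fun p _ _ => le_add_of_nonneg_right (by positivity)
    obtain ⟨hp1, hp2⟩ := Finset.mem_filter.1 hp
    exact Nat.mem_primesLE.2 ⟨Nat.le_floor hp2, Nat.prime_of_mem_primeFactors hp1⟩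
  · set T := n.primeFactors.filter (fun p : ℕ => ¬ (p : ℝ) ≤ y) with hT
    have hTy : ∀ p ∈ T, y < p := fun p hp => not_le.1 (Finset.mem_filter.1 hp).2
    have hcard : y ^ T.card ≤ n := by
      calc y ^ T.card = ∏ _p ∈ T, y := (Finset.prod_const y).symm
        _ ≤ ∏ p ∈ T, (p : ℝ) :=
          Finset.prod_le_prod (fun _ _ => by linarith) fun p hp => (hTy p hp).le
        _ ≤ (n : ℝ) := by
          have h : ∏ p ∈ T, p ∣ n :=
            (Finset.prod_dvd_prod_of_subset _ _ _ (Finset.filter_subset _ _)).trans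
              (Nat.prod_primeFactors_dvd n)
          have h2 := (Nat.cast_le (α := ℝ)).2 (Nat.le_of_dvd (Nat.pos_of_ne_zero hn) h)
          push_cast at h2
          exact h2
    have hcard2 : T.card * log y ≤ y := by
      rw [← log_pow, hy]
      exact log_le_log (by positivity) hcard
    calc ∏ p ∈ T, (1 + 1 / (p : ℝ)) ≤ ∏ _p ∈ T, exp (1 / y) := by
          refine Finset.prod_le_prod (fun _ _ => by positivity) fun p hp => ?_
          have h1 : 1 / (p : ℝ) ≤ 1 / y :=
            one_div_le_one_div_of_le (by linarith) (hTy p hp).le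
          linarith [add_one_le_exp (1 / y)]
      _ = exp (T.card * (1 / y)) := by rw [Finset.prod_const, exp_nat_mul]
      _ ≤ exp (1 / log y) := by
          rw [exp_le_exp, mul_one_div, div_le_div_iff₀ (by linarith) hly]
          linarith

/-- **Unitary divisor-sum.** With `σ*(n) = ∑_{d ∥ n} d` the sum of unitary divisors
(`d ∣ n` with `gcd(d, n/d) = 1`), one has
`limsup σ*(n)/(n log log n) = (6/π²) e^γ`. -/
theorem limsup_unitary_sigma_div_eq :
    Filter.limsup
      (fun n : ℕ =>
        ((∑ d ∈ n.divisors.filter (fun d => Nat.gcd d (n / d) = 1), d : ℕ) : ℝ) /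
          (n * Real.log (Real.log n)))
      Filter.atTop =
      6 / Real.pi ^ 2 * Real.exp Real.eulerMascheroniConstant := by
  set L := 6 / π ^ 2 * exp eulerMascheroniConstant with hL
  set Q : ℕ → ℝ := fun N => ∏ p ∈ N.primesLE, (1 + 1 / (p : ℝ)) with hQ
  set u : ℕ → ℝ := fun n =>
    ((∑ d ∈ n.divisors.filter (fun d => Nat.gcd d (n / d) = 1), d : ℕ) : ℝ) /
      (n * log (log n)) with hu
  have hQL : Tendsto (fun N => Q N / log N) atTop (nhds L) :=
    tendsto_prod_primesLE_one_add_inv_div_log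
  have hQ0 : ∀ N, 0 ≤ Q N := fun N => Finset.prod_nonneg fun p _ => by positivity
  have hlogn : Tendsto (fun n : ℕ => log (n : ℝ)) atTop atTop :=
    tendsto_log_atTop.comp tendsto_natCast_atTop_atTop
  have hfl : Tendsto (fun n : ℕ => ⌊log (n : ℝ)⌋₊) atTop atTop :=
    tendsto_nat_floor_atTop.comp hlogn
  have hv : Tendsto (fun n : ℕ => Q ⌊log (n : ℝ)⌋₊ / log ⌊log (n : ℝ)⌋₊ *
      exp (1 / log (log n))) atTop (nhds L) := by
    have h1 : Tendsto (fun n : ℕ => exp (1 / log (log n))) atTop (nhds 1) := by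
      have h2 : Tendsto (fun n : ℕ => (log (log (n : ℝ)))⁻¹) atTop (nhds 0) :=
        tendsto_inv_atTop_zero.comp (tendsto_log_atTop.comp hlogn)
      have h3 := (continuous_exp.tendsto 0).comp h2
      rw [exp_zero] at h3
      exact h3.congr fun n => by simp
    simpa using (hQL.comp hfl).mul h1
  have huv : u ≤ᶠ[atTop] fun n : ℕ => Q ⌊log (n : ℝ)⌋₊ / log ⌊log (n : ℝ)⌋₊ *
      exp (1 / log (log n)) := by
    filter_upwards [hlogn.eventually_ge_atTop 2, eventually_ne_atTop 0] with n hn hn0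
    have hn0' : (0 : ℝ) < n := by positivity
    have hf2 : (2 : ℝ) ≤ ⌊log (n : ℝ)⌋₊ := by
      have : 2 ≤ ⌊log (n : ℝ)⌋₊ := Nat.le_floor (by exact_mod_cast hn)
      exact_mod_cast this
    have hlf : 0 < log (⌊log (n : ℝ)⌋₊ : ℝ) := log_pos (by linarith)
    have hle : log (⌊log (n : ℝ)⌋₊ : ℝ) ≤ log (log n) :=
      log_le_log (by linarith) (Nat.floor_le (by linarith))
    have h1 := (sum_unitary_divisors_le hn0).trans (mul_le_mul_of_nonneg_left
      (prod_primeFactors_one_add_inv_le hn0 (by linarith)) hn0'.le)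
    calc u n ≤ (n * (Q ⌊log (n : ℝ)⌋₊ * exp (1 / log (log n)))) / (n * log (log n)) :=
          div_le_div_of_nonneg_right h1 (mul_nonneg hn0'.le (hlf.le.trans hle))
      _ = Q ⌊log (n : ℝ)⌋₊ * exp (1 / log (log n)) / log (log n) :=
          mul_div_mul_left _ _ hn0'.ne'
      _ ≤ Q ⌊log (n : ℝ)⌋₊ * exp (1 / log (log n)) / log ⌊log (n : ℝ)⌋₊ :=
          div_le_div_of_nonneg_left (mul_nonneg (hQ0 _) (exp_pos _).le) hlf hle
      _ = _ := by ring
  have hu0 : ∀ᶠ n in atTop, 0 ≤ u n := by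
    filter_upwards [hlogn.eventually_ge_atTop 1] with n hn
    exact div_nonneg (Nat.cast_nonneg _) (mul_nonneg (Nat.cast_nonneg _) (log_nonneg hn))
  have hub : IsBoundedUnder (· ≤ ·) atTop u := hv.isBoundedUnder_le.mono_le huv
  have hucb : IsCoboundedUnder (· ≤ ·) atTop u :=
    IsBoundedUnder.isCoboundedUnder_le ⟨0, eventually_map.2 hu0⟩
  refine le_antisymm ?_ ?_
  · exact (limsup_le_limsup huv hucb hv.isBoundedUnder_le).trans hv.limsup_eq.le
  have hw : Tendsto (fun N : ℕ => Q N / (log N + log (log 4))) atTop (nhds L) := by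
    have h1 : Tendsto (fun N : ℕ => 1 + log (log 4) * (log (N : ℝ))⁻¹) atTop (nhds 1) := by
      simpa using ((tendsto_inv_atTop_zero.comp hlogn).const_mul (log (log 4))).const_add 1
    have h2 := hQL.div h1 one_ne_zero
    rw [div_one] at h2
    refine h2.congr' ?_
    filter_upwards [hlogn.eventually_gt_atTop 0] with N hN
    rw [Pi.div_apply, div_div]
    congr 1
    field_simp
  have hprim : Tendsto primorial atTop atTop :=
    tendsto_atTop_mono (fun _ => le_primorial_self) tendsto_id
  have hlow : ∀ᶠ N : ℕ in atTop, Q N / (log N + log (log 4)) ≤ u (primorial N) := by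
    filter_upwards [(hlogn.comp hprim).eventually_gt_atTop 1, eventually_gt_atTop 0] with N hN hN0
    simp only [Function.comp_apply] at hN
    have hN0' : (0 : ℝ) < N := by exact_mod_cast hN0
    have hp0 : (0 : ℝ) < primorial N := by exact_mod_cast primorial_pos N
    have hl4 : 0 < log 4 := log_pos (by norm_num)
    have h1 : log (primorial N) ≤ N * log 4 := by
      rw [← log_pow]
      exact log_le_log hp0 (by exact_mod_cast primorial_le_four_pow N)
    have h2 : log (log (primorial N)) ≤ log N + log (log 4) := by
      rw [← log_mul hN0'.ne' hl4.ne']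
      exact log_le_log (by linarith) h1
    have h3 : u (primorial N) = Q N / log (log (primorial N)) := by
      simp only [hu]
      rw [sum_unitary_divisors_of_squarefree (squarefree_primorial N), primeFactors_primorial,
        mul_div_mul_left _ _ hp0.ne']
    rw [h3]
    exact div_le_div_of_nonneg_left (hQ0 N) (log_pos hN) h2
  refine le_of_forall_lt fun c hc => ?_
  obtain ⟨c', hcc', hc'⟩ := exists_between hc
  refine hcc'.trans_le (le_limsup_of_frequently_le (hprim.frequently ?_) hub)
  refine Eventually.frequently ?_
  filter_upwards [hlow, hw.eventually (lt_mem_nhds hc')] with N h1 h2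
  exact h2.le.trans h1
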